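/- (Adequacy, completeness direction) Let R be a TRS with simulating GRS G(R) and let S be a term graph with term(S) = s. If s →_{R,p} t, then there exist term graphs U, V, T such that S ▷_p^! U, U ⊐_p^! V, V ⇒_{G(R),p} T and term(T) = t. -/

import Mathlib

namespace TermGraphs

/-- First-order terms over a signature `F` and variables `V`. -/
inductive Tm (F V : Type) : Type
  | var : V → Tm F V
  | app : F → List (Tm F V) → Tm F V

/-- A (pre-)graph over labels `L`: a finite set of nodes (drawn from `ℕ`),
a successor map assigning each node an ordered sequence of nodes,
a labelling, and a designated root node. -/
structure PreGraph (L : Type) where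
  nodes : Finset ℕ
  suc : ℕ → List ℕ
  lab : ℕ → L
  root : ℕ

variable {F V L : Type}

/-- The edge relation of a graph: `u → v` iff `v` occurs in `suc u`. -/
def Edge (G : PreGraph L) (u v : ℕ) : Prop := u ∈ G.nodes ∧ v ∈ G.suc u

/-- `v` is reachable from `u` in `G`. -/
def Reach (G : PreGraph L) : ℕ → ℕ → Prop := Relation.ReflTransGen (Edge G)

/-- `ReachesP G u p v`: starting in `u` and following the position `p`
(a sequence of argument indices) one reaches the node `v`. -/
inductive ReachesP (G : PreGraph L) : ℕ → List ℕ → ℕ → Prop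
  | nil (u : ℕ) : ReachesP G u [] u
  | cons {u v w : ℕ} {i : ℕ} {p : List ℕ} :
      u ∈ G.nodes → (G.suc u)[i]? = some v → ReachesP G v p w →
      ReachesP G u (i :: p) w

/-- `p` is a position of the node `u` in `G`, i.e. `p ∈ Pos_G(u)`. -/
def IsPos (G : PreGraph L) (u : ℕ) (p : List ℕ) : Prop := ReachesP G G.root p u

/-- A node is unshared if its set of positions is a singleton. -/
def Unshared (G : PreGraph L) (u : ℕ) : Prop := ∃! p, IsPos G u p

/-- A node `u` is strictly below the position `p` if `p` is a proper prefix of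
some position of `u`. -/
def StrictlyBelow (G : PreGraph L) (p : List ℕ) (u : ℕ) : Prop :=
  ∃ q, IsPos G u q ∧ p <+: q ∧ p ≠ q

open Classical in
/-- `S↾u`, the subgraph of `S` reachable from the node `u`. -/
noncomputable def subgraph (G : PreGraph L) (u : ℕ) : PreGraph L where
  nodes := G.nodes.filter fun v => Reach G u v
  suc := G.suc
  lab := G.lab
  root := u

/-- The union `G ∪ H` of two graphs (for properly sharing graphs this
is symmetric on the common nodes). -/
def gUnion (G H : PreGraph L) : PreGraph L where
  nodes := G.nodes ∪ H.nodes
  suc := fun u => if u ∈ G.nodes then G.suc u else H.suc u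
  lab := fun u => if u ∈ G.nodes then G.lab u else H.lab u
  root := G.root

/-- Two graphs are properly sharing if every common node carries the same
label and the same successor sequence in both. -/
def ProperlySharing (G H : PreGraph L) : Prop :=
  ∀ u, u ∈ G.nodes → u ∈ H.nodes → G.lab u = H.lab u ∧ G.suc u = H.suc u

/-- The redirection `G[u ≫ v]`: the node `u` is removed (and `v` added), and
`u` is replaced by `v` in all successor sequences. -/
def redirect (G : PreGraph L) (u v : ℕ) : PreGraph L where
  nodes := insert v (G.nodes.erase u)
  suc := fun w => (G.suc w).map fun x => if x = u then v else x
  lab := G.lab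
  root := if G.root = u then v else G.root

/-- The replacement `G[u ← H]`: the subgraph of `G[u ≫ root(H)] ∪ H` reachable
from `root(H)` if `u = root(G)`, and from `root(G)` otherwise. -/
noncomputable def replaceAt (G : PreGraph L) (u : ℕ) (H : PreGraph L) : PreGraph L :=
  subgraph (gUnion H (redirect G u H.root)) (if u = G.root then H.root else G.root)

/-- A term graph over the signature `F` (with arities `ar`) and variables `V`:
an acyclic rooted graph whose nodes are labelled by function symbols or
variables, such that a node labelled by `f` has `ar f` successors, a node
labelled by a variable has no successors, and variable nodes are shared. -/
structure IsTermGraph (ar : F → ℕ) (G : PreGraph (F ⊕ V)) : Prop where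
  closed : ∀ u ∈ G.nodes, ∀ v ∈ G.suc u, v ∈ G.nodes
  acyclic : ∀ u v : ℕ, Relation.TransGen (Edge G) u v → u ≠ v
  rootMem : G.root ∈ G.nodes
  rootReach : ∀ u ∈ G.nodes, Reach G G.root u
  funArity : ∀ u ∈ G.nodes, ∀ f : F, G.lab u = Sum.inl f → (G.suc u).length = ar f
  varSuc : ∀ u ∈ G.nodes, ∀ x : V, G.lab u = Sum.inr x → G.suc u = []
  varShared : ∀ u ∈ G.nodes, ∀ v ∈ G.nodes, ∀ x : V,
      G.lab u = Sum.inr x → G.lab v = Sum.inr x → u = v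

/-- Fuelled computation of the term represented by (the subgraph at) a node.
For a term graph, any fuel strictly exceeding the length of the longest
path suffices; acyclicity bounds path lengths by the number of nodes. -/
noncomputable def termAt [Inhabited V] (G : PreGraph (F ⊕ V)) : ℕ → ℕ → Tm F V
  | 0, _ => Tm.var default
  | fuel + 1, u =>
    match G.lab u with
    | Sum.inr x => Tm.var x
    | Sum.inl f => Tm.app f ((G.suc u).map fun v => termAt G fuel v)

/-- `term(G)`, the term represented by the term graph `G`. -/
noncomputable def termOf [Inhabited V] (G : PreGraph (F ⊕ V)) : Tm F V :=
  termAt G (G.nodes.card + 1) G.root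

/-- Application of a substitution `σ : V → Tm F V` to a term. -/
def substTm (σ : V → Tm F V) : Tm F V → Tm F V
  | Tm.var x => σ x
  | Tm.app f ts => Tm.app f (ts.attach.map fun t => substTm σ t.1)
decreasing_by
  have := List.sizeOf_lt_of_mem t.2
  simp only [Tm.app.sizeOf_spec]
  omega

/-- The variable `x` occurs in the term `t`. -/
inductive OccursIn (x : V) : Tm F V → Prop
  | var : OccursIn x (Tm.var x)
  | app {f : F} {ts : List (Tm F V)} {t : Tm F V} :
      t ∈ ts → OccursIn x t → OccursIn x (Tm.app f ts)

/-- A morphism `m : L → S` of term graphs: it maps nodes to nodes, root to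
root, and preserves labels and successor sequences at every node of `L`
labelled by a function symbol. -/
structure IsMorphism (L S : PreGraph (F ⊕ V)) (m : ℕ → ℕ) : Prop where
  maps : ∀ u ∈ L.nodes, m u ∈ S.nodes
  root : m L.root = S.root
  lab : ∀ u ∈ L.nodes, ∀ f : F, L.lab u = Sum.inl f → S.lab (m u) = Sum.inl f
  suc : ∀ u ∈ L.nodes, ∀ f : F, L.lab u = Sum.inl f → S.suc (m u) = (L.suc u).map m

/-- `S ≥_m T`: `m` is a morphism whose label and successor conditions hold at
*all* nodes of `S`, including variable nodes. -/
structure IsGeMorph (S T : PreGraph (F ⊕ V)) (m : ℕ → ℕ) : Prop where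
  maps : ∀ u ∈ S.nodes, m u ∈ T.nodes
  root : m S.root = T.root
  lab : ∀ u ∈ S.nodes, T.lab (m u) = S.lab u
  suc : ∀ u ∈ S.nodes, T.suc (m u) = (S.suc u).map m

open Classical in
/-- The substitution `σ_m` induced by a morphism `m : L → S`: a variable `x`
labelling the (unique) node `u` of `L` is mapped to `term(S↾m(u))`. -/
noncomputable def inducedSubst [Inhabited V] (L S : PreGraph (F ⊕ V)) (m : ℕ → ℕ) :
    V → Tm F V := fun x =>
  if h : ∃ u, u ∈ L.nodes ∧ L.lab u = Sum.inr x then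
    termOf (subgraph S (m h.choose))
  else Tm.var x

/-- `S ⊒_{u,v} T` (for nodes `u ≽ v` of `S`, taking `≻` to be the usual order
on `ℕ`): `S ≥_m T` for the morphism `m` with `m u = v` and `m w = w` for all
other nodes `w`. -/
def Collapse (S T : PreGraph (F ⊕ V)) (u v : ℕ) : Prop :=
  u ∈ S.nodes ∧ v ∈ S.nodes ∧ v ≤ u ∧
    IsGeMorph S T (fun w => if w = u then v else w)

/-- `S ⊐_{u,v} T`: `S ⊒_{u,v} T` with `u ≠ v`. -/
def CollapseS (S T : PreGraph (F ⊕ V)) (u v : ℕ) : Prop :=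
  Collapse S T u v ∧ u ≠ v

/-- The single-step folding relation `S ⊐ T`. -/
def Fold (S T : PreGraph (F ⊕ V)) : Prop := ∃ u v, CollapseS S T u v

/-- `S ⊐_p T`: `S` folds strictly below the position `p` to `T`. -/
def FoldBelow (p : List ℕ) (S T : PreGraph (F ⊕ V)) : Prop :=
  ∃ u v, CollapseS S T u v ∧ StrictlyBelow S p u ∧ StrictlyBelow S p v

/-- `S ▷_p T`: `S` unfolds above the position `p` to `T`, i.e. `T ⊐_{u,v} S`
for some node `u` of `T` that is unshared in `T` and whose unique position is
a prefix of `p`. -/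
def UnfoldAbove (p : List ℕ) (S T : PreGraph (F ⊕ V)) : Prop :=
  ∃ u v, CollapseS T S u v ∧ ∃ q, q <+: p ∧ (∀ q', IsPos T u q' ↔ q' = q)

/-- The relation `⊐` restricted to term graphs. -/
def FoldTG (ar : F → ℕ) (S T : PreGraph (F ⊕ V)) : Prop :=
  IsTermGraph ar S ∧ IsTermGraph ar T ∧ Fold S T

/-- The relation `⊐_p` restricted to term graphs. -/
def FoldBelowTG (ar : F → ℕ) (p : List ℕ) (S T : PreGraph (F ⊕ V)) : Prop :=
  IsTermGraph ar S ∧ IsTermGraph ar T ∧ FoldBelow p S T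

/-- The relation `▷_p` restricted to term graphs. -/
def UnfoldAboveTG (ar : F → ℕ) (p : List ℕ) (S T : PreGraph (F ⊕ V)) : Prop :=
  IsTermGraph ar S ∧ IsTermGraph ar T ∧ UnfoldAbove p S T

/-- `a →^! b` for an abstract relation `r`: `a r^* b` and `b` is `r`-minimal. -/
def NormTo {α : Type _} (r : α → α → Prop) (a b : α) : Prop :=
  Relation.ReflTransGen r a b ∧ ∀ c, ¬ r b c

/-- The `n`-fold composition of an abstract relation. -/
def Iter {α : Type _} (r : α → α → Prop) : ℕ → α → α → Prop
  | 0 => Eq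
  | n + 1 => fun a c => ∃ b, r a b ∧ Iter r n b c

/-- The node `u` of `G` is labelled by a variable. -/
def IsVarNode (G : PreGraph (F ⊕ V)) (u : ℕ) : Prop := ∃ x : V, G.lab u = Sum.inr x

/-- A graph rewrite rule `L → R`: `L` and `R` are properly sharing term
graphs, `root(L)` is not a variable node, every variable of `R` occurs in
`L`, and `root(L)` is not a node of `R`. -/
structure IsRule (ar : F → ℕ) (Lhs Rhs : PreGraph (F ⊕ V)) : Prop where
  lhs : IsTermGraph ar Lhs
  rhs : IsTermGraph ar Rhs
  sharing : ProperlySharing Lhs Rhs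
  rootNotVar : ¬ IsVarNode Lhs Lhs.root
  varsSub : ∀ x : V, (∃ u ∈ Rhs.nodes, Rhs.lab u = Sum.inr x) →
      (∃ u ∈ Lhs.nodes, Lhs.lab u = Sum.inr x)
  rootNotInRhs : Lhs.root ∉ Rhs.nodes

/-- `m(R)`: the graph obtained from `R` by replacing every node `v` in the
domain `dom` of the morphism `m` by `m v`; the replaced nodes keep the labels
and successor sequences they have in `S`. -/
def applyMorph (dom : Finset ℕ) (m : ℕ → ℕ) (S R : PreGraph (F ⊕ V)) :
    PreGraph (F ⊕ V) where
  nodes := R.nodes.image fun v => if v ∈ dom then m v else v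
  suc := fun w => if w ∈ S.nodes then S.suc w
                  else (R.suc w).map fun x => if x ∈ dom then m x else x
  lab := fun w => if w ∈ S.nodes then S.lab w else R.lab w
  root := if R.root ∈ dom then m R.root else R.root

/-- `φ` exhibits `G'` as an isomorphic copy of `G`. -/
structure GIsoOn (φ : ℕ → ℕ) (G G' : PreGraph (F ⊕ V)) : Prop where
  nodes : G'.nodes = G.nodes.image φ
  root : φ G.root = G'.root
  lab : ∀ u ∈ G.nodes, G'.lab (φ u) = G.lab u
  suc : ∀ u ∈ G.nodes, G'.suc (φ u) = (G.suc u).map φ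

/-- `L' → R'` is a renaming of the rule `L → R` with respect to `S`: an
isomorphic copy that is node-disjoint from `S`. -/
def IsRenaming (L R L' R' S : PreGraph (F ⊕ V)) : Prop :=
  ∃ φ : ℕ → ℕ, Set.InjOn φ ↑(L.nodes ∪ R.nodes) ∧
    GIsoOn φ L L' ∧ GIsoOn φ R R' ∧ Disjoint (L'.nodes ∪ R'.nodes) S.nodes

/-- `S ⇒_{G,u} T`: a graph rewrite step at the node `u`, using a renaming
`L' → R'` of some rule of `G`, a morphism `m : L' → S↾u`, and
`T = S[u ← m(R')]`. -/
def GStepAt (G : Set (PreGraph (F ⊕ V) × PreGraph (F ⊕ V))) (u : ℕ)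
    (S T : PreGraph (F ⊕ V)) : Prop :=
  ∃ LR ∈ G, ∃ L' R' : PreGraph (F ⊕ V), ∃ m : ℕ → ℕ,
    IsRenaming LR.1 LR.2 L' R' S ∧
    IsMorphism L' (subgraph S u) m ∧
    T = replaceAt S u (applyMorph L'.nodes m S R')

/-- `S ⇒_{G,p} T`: a graph rewrite step at the node corresponding to the
position `p`. -/
def GStepP (G : Set (PreGraph (F ⊕ V) × PreGraph (F ⊕ V))) (p : List ℕ)
    (S T : PreGraph (F ⊕ V)) : Prop :=
  ∃ u, IsPos S u p ∧ GStepAt G u S T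

/-- A term rewrite system: a finite set of rules `l → r` where `l` is not a
variable and every variable of `r` occurs in `l`. -/
def IsTRS (R : Set (Tm F V × Tm F V)) : Prop :=
  R.Finite ∧ ∀ lr ∈ R, (∀ x : V, lr.1 ≠ Tm.var x) ∧
    ∀ x : V, OccursIn x lr.2 → OccursIn x lr.1

/-- `s →_{R,p} t`: a rewrite step of the TRS `R` at position `p`. -/
inductive RewriteAt (R : Set (Tm F V × Tm F V)) : List ℕ → Tm F V → Tm F V → Prop
  | root {l r : Tm F V} (σ : V → Tm F V) :
      (l, r) ∈ R → RewriteAt R [] (substTm σ l) (substTm σ r)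
  | congr {i : ℕ} {p : List ℕ} {f : F} {ts : List (Tm F V)} {t t' : Tm F V} :
      ts[i]? = some t → RewriteAt R p t t' →
      RewriteAt R (i :: p) (Tm.app f ts) (Tm.app f (ts.set i t'))

/-- A graph is minimally sharing if every node is a variable node or unshared. -/
def MinimallySharing (G : PreGraph (F ⊕ V)) : Prop :=
  ∀ u ∈ G.nodes, IsVarNode G u ∨ Unshared G u

/-- A graph is maximally sharing if distinct nodes represent distinct terms. -/
def MaximallySharing [Inhabited V] (G : PreGraph (F ⊕ V)) : Prop :=
  ∀ u ∈ G.nodes, ∀ v ∈ G.nodes,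
    termOf (subgraph G u) = termOf (subgraph G v) → u = v

/-- `G ∈ Tree(s)`: `G` is a minimally sharing term graph representing `s`. -/
def InTree [Inhabited V] (ar : F → ℕ) (s : Tm F V) (G : PreGraph (F ⊕ V)) : Prop :=
  IsTermGraph ar G ∧ MinimallySharing G ∧ termOf G = s

/-- `G ∈ Shared(s)`: `G` is a maximally sharing term graph representing `s`. -/
def InShared [Inhabited V] (ar : F → ℕ) (s : Tm F V) (G : PreGraph (F ⊕ V)) : Prop :=
  IsTermGraph ar G ∧ MaximallySharing G ∧ termOf G = s

/-- `L → R` is a graph rewrite rule simulating the term rewrite rule `l → r`: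
`L ∈ Tree(l)`, `R ∈ Tree(r)` and the common nodes of `L` and `R` are exactly
the variable nodes of `R`. -/
def SimRule [Inhabited V] (ar : F → ℕ) (l r : Tm F V)
    (Lg Rg : PreGraph (F ⊕ V)) : Prop :=
  IsRule ar Lg Rg ∧ InTree ar l Lg ∧ InTree ar r Rg ∧
    ∀ w : ℕ, (w ∈ Lg.nodes ∧ w ∈ Rg.nodes) ↔ (w ∈ Rg.nodes ∧ IsVarNode Rg w)

/-- `G` is the simulating graph rewrite system `G(R)` of the TRS `R`. -/
def IsSimGRS [Inhabited V] (ar : F → ℕ) (R : Set (Tm F V × Tm F V))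
    (G : Set (PreGraph (F ⊕ V) × PreGraph (F ⊕ V))) : Prop :=
  (∀ lr ∈ R, ∃ LR ∈ G, SimRule ar lr.1 lr.2 LR.1 LR.2) ∧
  (∀ LR ∈ G, ∃ lr ∈ R, SimRule ar lr.1 lr.2 LR.1 LR.2)

/-- `S ⇒ˢ_{G,p} T`: `S ▷_p^! U`, `U ⊐_p^! V` and `V ⇒_{G,p} T` for some
term graphs `U`, `V`. -/
def SStepP (ar : F → ℕ) (G : Set (PreGraph (F ⊕ V) × PreGraph (F ⊕ V)))
    (p : List ℕ) (S T : PreGraph (F ⊕ V)) : Prop :=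
  ∃ U Vg : PreGraph (F ⊕ V),
    NormTo (UnfoldAboveTG ar p) S U ∧ NormTo (FoldBelowTG ar p) U Vg ∧
    GStepP G p Vg T

/-- `S ⇒ˢ_G T`: an `⇒ˢ`-step at some position. -/
def SStep (ar : F → ℕ) (G : Set (PreGraph (F ⊕ V) × PreGraph (F ⊕ V)))
    (S T : PreGraph (F ⊕ V)) : Prop :=
  ∃ p : List ℕ, SStepP ar G p S T

/-- `G` has a path of `n` edges. -/
def HasPathLen (G : PreGraph L) (n : ℕ) : Prop :=
  ∃ l : List ℕ, l.length = n + 1 ∧ l.Chain' (Edge G) ∧ ∀ x ∈ l, x ∈ G.nodes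

/-- The depth of `G`: the length of the longest path in `G`. -/
noncomputable def depth (G : PreGraph L) : ℕ := sSup {n | HasPathLen G n}

/-- Filling every hole of a context (a term over `F ∪ {□}`, the hole `□`
being represented by `none`) with the term `t`. -/
def fillAll (t : Tm F V) : Tm (Option F) V → Tm F V
  | Tm.var x => Tm.var x
  | Tm.app none _ => t
  | Tm.app (some f) ts => Tm.app f (ts.attach.map fun c => fillAll t c.1)
decreasing_by
  have := List.sizeOf_lt_of_mem c.2
  simp only [Tm.app.sizeOf_spec]
  omega

/-- Viewing a graph over `F ∪ V` as a graph over `(F ∪ {□}) ∪ V`. -/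
def relabel (G : PreGraph (F ⊕ V)) : PreGraph (Option F ⊕ V) where
  nodes := G.nodes
  suc := G.suc
  lab := fun u => Sum.map some id (G.lab u)
  root := G.root

/-- The one-node graph consisting of a hole node `h` labelled `□`. -/
def holeGraph (h : ℕ) : PreGraph (Option F ⊕ V) where
  nodes := {h}
  suc := fun _ => []
  lab := fun _ => Sum.inl none
  root := h

section Paths

variable {A : Type} {G : PreGraph A}

theorem ReachesP.append {u v w : ℕ} {p q : List ℕ} (h : ReachesP G u p v)
    (h' : ReachesP G v q w) : ReachesP G u (p ++ q) w := by
  induction h with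
  | nil => exact h'
  | cons hu hi _ ih => exact .cons hu hi (ih h')

theorem ReachesP.split {u w : ℕ} {p q : List ℕ} (h : ReachesP G u (p ++ q) w) :
    ∃ v, ReachesP G u p v ∧ ReachesP G v q w := by
  induction p generalizing u with
  | nil => exact ⟨u, .nil u, h⟩
  | cons i p ih =>
    cases h with
    | cons hu hi h =>
      obtain ⟨v, h1, h2⟩ := ih h
      exact ⟨v, .cons hu hi h1, h2⟩

theorem ReachesP.unique {u v w : ℕ} {p : List ℕ} (h : ReachesP G u p v)
    (h' : ReachesP G u p w) : v = w := by
  induction h with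
  | nil => cases h'; rfl
  | cons hu hi _ ih =>
    cases h' with
    | cons _ hi' h' =>
      rw [hi] at hi'
      cases hi'
      exact ih h'

theorem reachesP_singleton {u v i : ℕ} :
    ReachesP G u [i] v ↔ u ∈ G.nodes ∧ (G.suc u)[i]? = some v := by
  constructor
  · intro h
    cases h with
    | cons hu hi h => cases h; exact ⟨hu, hi⟩
  · rintro ⟨hu, hi⟩
    exact .cons hu hi (.nil v)

theorem ReachesP.reach {u v : ℕ} {p : List ℕ} (h : ReachesP G u p v) : Reach G u v := by
  induction h with
  | nil => exact .refl
  | cons hu hi _ ih => exact .head ⟨hu, List.mem_of_getElem? hi⟩ ih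

theorem Reach.of_eq {u v : ℕ} (h : u = v) : Reach G u v := h ▸ Relation.ReflTransGen.refl

theorem IsPos.eq_root {u : ℕ} (h : IsPos G u []) : u = G.root :=
  ReachesP.unique h (.nil _)

theorem exists_reachesP_of_reach {u v : ℕ} (h : Reach G u v) : ∃ p, ReachesP G u p v := by
  induction h with
  | refl => exact ⟨[], .nil u⟩
  | tail _ e ih =>
    obtain ⟨p, hp⟩ := ih
    obtain ⟨i, hi⟩ := List.mem_iff_getElem?.1 e.2
    exact ⟨p ++ [i], hp.append (reachesP_singleton.2 ⟨e.1, hi⟩)⟩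

theorem ReachesP.transGen {u v : ℕ} {p : List ℕ} (h : ReachesP G u p v) (hp : p ≠ []) :
    Relation.TransGen (Edge G) u v := by
  cases h with
  | nil => exact absurd rfl hp
  | cons hu hi h => exact .head' ⟨hu, List.mem_of_getElem? hi⟩ h.reach

theorem ReachesP.mem (hc : ∀ u ∈ G.nodes, ∀ v ∈ G.suc u, v ∈ G.nodes) {u v : ℕ} {p : List ℕ}
    (hu : u ∈ G.nodes) (h : ReachesP G u p v) : v ∈ G.nodes := by
  induction h with
  | nil => exact hu
  | cons hu hi _ ih => exact ih (hc _ hu _ (List.mem_of_getElem? hi))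

/-- The node at position `p`, if any, has no further position. -/
def UnsharedAt (G : PreGraph A) (p : List ℕ) : Prop :=
  ∀ w q, IsPos G w p → IsPos G w q → q = p

end Paths

section TermGraph

variable {ar : F → ℕ} {G S T : PreGraph (F ⊕ V)}

theorem IsTermGraph.exists_isPos (h : IsTermGraph ar G) {u : ℕ} (hu : u ∈ G.nodes) :
    ∃ p, IsPos G u p :=
  exists_reachesP_of_reach (h.rootReach u hu)

theorem IsTermGraph.isPos_mem (h : IsTermGraph ar G) {u : ℕ} {p : List ℕ} (hp : IsPos G u p) :
    u ∈ G.nodes :=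
  ReachesP.mem h.closed h.rootMem hp

theorem IsTermGraph.eq_nil_of_reachesP_self (h : IsTermGraph ar G) {u : ℕ} {p : List ℕ}
    (hp : ReachesP G u p u) : p = [] := by
  by_contra hne
  exact h.acyclic _ _ (hp.transGen hne) rfl

/-- `Rep ar G u t`: the node `u` of `G` represents the term `t`. -/
inductive Rep (ar : F → ℕ) (G : PreGraph (F ⊕ V)) : ℕ → Tm F V → Prop
  | var {u : ℕ} {x : V} : u ∈ G.nodes → G.lab u = Sum.inr x → G.suc u = [] →
      Rep ar G u (Tm.var x)
  | app {u : ℕ} {f : F} {ts : List (Tm F V)} : u ∈ G.nodes → G.lab u = Sum.inl f →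
      (G.suc u).length = ar f → ts.length = (G.suc u).length →
      (∀ (i v : ℕ) (t : Tm F V), (G.suc u)[i]? = some v → ts[i]? = some t → Rep ar G v t) →
      Rep ar G u (Tm.app f ts)

theorem Rep.mem {u : ℕ} {t : Tm F V} (h : Rep ar G u t) : u ∈ G.nodes := by
  cases h <;> assumption

theorem Rep.unique {u : ℕ} {t t' : Tm F V} (h : Rep ar G u t) (h' : Rep ar G u t') :
    t = t' := by
  induction h generalizing t' with
  | var _ hl _ =>
    cases h' with
    | var _ hl' _ => rw [hl] at hl'; cases hl'; rfl
    | app _ hl' => rw [hl] at hl'; cases hl'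
  | app hu hl _ hlen _ ih =>
    cases h' with
    | var _ hl' _ => rw [hl] at hl'; cases hl'
    | app _ hl' _ hlen' hsub' =>
      rw [hl] at hl'
      cases hl'
      congr 1
      apply List.ext_getElem (hlen.trans hlen'.symm)
      intro i h1 h2
      have h3 := hlen ▸ h1
      exact ih i _ _ (List.getElem?_eq_getElem h3) (List.getElem?_eq_getElem h1)
        (hsub' i _ _ (List.getElem?_eq_getElem h3) (List.getElem?_eq_getElem h2))

theorem Rep.of_edge {u v : ℕ} {t : Tm F V} (h : Rep ar G u t) (e : v ∈ G.suc u) :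
    ∃ t', Rep ar G v t' ∧ sizeOf t' < sizeOf t := by
  cases h with
  | var _ _ hs => rw [hs] at e; cases e
  | @app _ f ts _ _ _ hlen hsub =>
    obtain ⟨i, hi⟩ := List.mem_iff_getElem?.1 e
    obtain ⟨hlt, -⟩ := List.getElem?_eq_some_iff.1 hi
    have hlt' : i < ts.length := hlen ▸ hlt
    refine ⟨ts[i], hsub i v _ hi (List.getElem?_eq_getElem hlt'), ?_⟩
    have := List.sizeOf_lt_of_mem (List.getElem_mem hlt')
    simp only [Tm.app.sizeOf_spec]
    omega

theorem Rep.of_transGen {u v : ℕ} {t : Tm F V} (h : Rep ar G u t)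
    (e : Relation.TransGen (Edge G) u v) : ∃ t', Rep ar G v t' ∧ sizeOf t' < sizeOf t := by
  induction e with
  | single e => exact h.of_edge e.2
  | tail _ e ih =>
    obtain ⟨t', h', hlt⟩ := ih
    obtain ⟨t'', h'', hlt'⟩ := h'.of_edge e.2
    exact ⟨t'', h'', hlt'.trans hlt⟩

theorem isTermGraph_of_rep (hmem : G.root ∈ G.nodes)
    (hreach : ∀ u ∈ G.nodes, Reach G G.root u)
    (hrep : ∀ u ∈ G.nodes, ∃ t, Rep ar G u t)
    (hvar : ∀ u ∈ G.nodes, ∀ v ∈ G.nodes, ∀ x : V,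
      G.lab u = Sum.inr x → G.lab v = Sum.inr x → u = v) : IsTermGraph ar G where
  closed u hu v hv := by
    obtain ⟨t, ht⟩ := hrep u hu
    obtain ⟨t', ht', -⟩ := ht.of_edge hv
    exact ht'.mem
  acyclic u v h := by
    rintro rfl
    obtain ⟨c, hc, -⟩ := Relation.TransGen.head'_iff.1 h
    obtain ⟨t, ht⟩ := hrep u hc.1
    obtain ⟨t', ht', hlt⟩ := ht.of_transGen h
    rw [ht.unique ht'] at hlt
    exact lt_irrefl _ hlt
  rootMem := hmem
  rootReach := hreach
  funArity u hu f hf := by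
    obtain ⟨t, ht⟩ := hrep u hu
    cases ht with
    | var _ hl => rw [hf] at hl; cases hl
    | app _ hl har => rw [hf] at hl; cases hl; exact har
  varSuc u hu x hx := by
    obtain ⟨t, ht⟩ := hrep u hu
    cases ht with
    | var _ _ hs => exact hs
    | app _ hl => rw [hx] at hl; cases hl
  varShared := hvar

open Classical in
theorem IsTermGraph.rep_termAt [Inhabited V] (h : IsTermGraph ar G) (n : ℕ) (u : ℕ)
    (hu : u ∈ G.nodes) (hn : (G.nodes.filter fun v => Reach G u v).card ≤ n) :
    Rep ar G u (termAt G n u) := by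
  induction n generalizing u with
  | zero =>
    have : u ∈ G.nodes.filter fun v => Reach G u v :=
      Finset.mem_filter.2 ⟨hu, Relation.ReflTransGen.refl⟩
    rw [Finset.card_eq_zero.1 (Nat.le_zero.1 hn)] at this
    simp at this
  | succ n ih =>
    rw [termAt]
    cases hl : G.lab u with
    | inr x => exact .var hu hl (h.varSuc u hu x hl)
    | inl f =>
      refine .app hu hl (h.funArity u hu f hl) (by simp) ?_
      intro i v t hv ht
      rw [List.getElem?_map, hv] at ht
      cases ht
      have hvm := List.mem_of_getElem? hv
      refine ih v (h.closed u hu v hvm) ?_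
      refine Nat.lt_succ_iff.1 (lt_of_lt_of_le (Finset.card_lt_card ?_) hn)
      refine (Finset.ssubset_iff_of_subset ?_).2 ⟨u, ?_, ?_⟩
      · intro w hw
        rw [Finset.mem_filter] at hw ⊢
        exact ⟨hw.1, Relation.ReflTransGen.head ⟨hu, hvm⟩ hw.2⟩
      · exact Finset.mem_filter.2 ⟨hu, Relation.ReflTransGen.refl⟩
      · intro hw
        exact h.acyclic u u (Relation.TransGen.head' ⟨hu, hvm⟩ (Finset.mem_filter.1 hw).2) rfl

theorem IsTermGraph.rep_termOf [Inhabited V] (h : IsTermGraph ar G) :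
    Rep ar G G.root (termOf G) := by
  classical
  exact h.rep_termAt _ _ h.rootMem ((Finset.card_filter_le _ _).trans (Nat.le_succ _))

theorem IsTermGraph.exists_rep [Inhabited V] (h : IsTermGraph ar G) {u : ℕ}
    (hu : u ∈ G.nodes) : ∃ t, Rep ar G u t := by
  classical
  exact ⟨_, h.rep_termAt _ u hu le_rfl⟩

theorem Rep.subgraph {r u : ℕ} {t : Tm F V} (h : Rep ar G u t) (hr : Reach G r u) :
    Rep ar (subgraph G r) u t := by
  classical
  induction h with
  | var hu hl hs => exact .var (Finset.mem_filter.2 ⟨hu, hr⟩) hl hs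
  | app hu hl har hlen _ ih =>
    refine .app (Finset.mem_filter.2 ⟨hu, hr⟩) hl har hlen ?_
    intro i v t hv ht
    exact ih i v t hv ht (Relation.ReflTransGen.tail hr ⟨hu, List.mem_of_getElem? hv⟩)

theorem isTermGraph_subgraph {r : ℕ} (hr : r ∈ G.nodes)
    (hrep : ∀ u ∈ G.nodes, ∃ t, Rep ar G u t)
    (hvar : ∀ u ∈ G.nodes, ∀ v ∈ G.nodes, ∀ x : V,
      G.lab u = Sum.inr x → G.lab v = Sum.inr x → u = v) :
    IsTermGraph ar (subgraph G r) := by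
  classical
  refine isTermGraph_of_rep ?_ ?_ ?_ ?_
  · exact Finset.mem_filter.2 ⟨hr, Relation.ReflTransGen.refl⟩
  · intro u hu
    have h := (Finset.mem_filter.1 hu).2
    clear hu
    change Reach (subgraph G r) r u
    induction h with
    | refl => exact Relation.ReflTransGen.refl
    | tail h e ih => exact Relation.ReflTransGen.tail ih ⟨Finset.mem_filter.2 ⟨e.1, h⟩, e.2⟩
  · intro u hu
    obtain ⟨h1, h2⟩ := Finset.mem_filter.1 hu
    obtain ⟨t, ht⟩ := hrep u h1
    exact ⟨t, ht.subgraph h2⟩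
  · intro u hu v hv
    exact hvar u (Finset.mem_filter.1 hu).1 v (Finset.mem_filter.1 hv).1

section Morphism

variable {m : ℕ → ℕ}

theorem IsGeMorph.reachesP (hm : IsGeMorph S T m) {a b : ℕ} {p : List ℕ}
    (h : ReachesP S a p b) : ReachesP T (m a) p (m b) := by
  induction h with
  | nil => exact .nil _
  | cons hu hi _ ih =>
    refine .cons (hm.maps _ hu) ?_ ih
    rw [hm.suc _ hu, List.getElem?_map, hi]
    rfl

theorem IsGeMorph.isPos (hm : IsGeMorph S T m) {a : ℕ} {p : List ℕ}
    (h : IsPos S a p) : IsPos T (m a) p := by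
  have := hm.reachesP h
  rwa [hm.root] at this

theorem IsGeMorph.lift (hm : IsGeMorph S T m)
    (hc : ∀ u ∈ S.nodes, ∀ v ∈ S.suc u, v ∈ S.nodes) {a b : ℕ} {p : List ℕ}
    (ha : a ∈ S.nodes) (h : ReachesP T (m a) p b) : ∃ c, ReachesP S a p c ∧ m c = b := by
  induction p generalizing a with
  | nil => cases h; exact ⟨a, .nil a, rfl⟩
  | cons i p ih =>
    cases h with
    | cons hu hi h =>
      rw [hm.suc a ha, List.getElem?_map, Option.map_eq_some_iff] at hi
      obtain ⟨v, hv, rfl⟩ := hi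
      obtain ⟨c, hc1, hc2⟩ := ih (hc a ha v (List.mem_of_getElem? hv)) h
      exact ⟨c, .cons ha hv hc1, hc2⟩

theorem IsGeMorph.lift_isPos (hm : IsGeMorph S T m)
    (hc : ∀ u ∈ S.nodes, ∀ v ∈ S.suc u, v ∈ S.nodes) (hr : S.root ∈ S.nodes)
    {b : ℕ} {p : List ℕ} (h : IsPos T b p) : ∃ c, IsPos S c p ∧ m c = b := by
  apply hm.lift hc hr
  rw [hm.root]
  exact h

theorem IsGeMorph.rep (hm : IsGeMorph S T m) {u : ℕ} {t : Tm F V} (h : Rep ar S u t) :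
    Rep ar T (m u) t := by
  induction h with
  | var hu hl hs =>
    exact .var (hm.maps _ hu) ((hm.lab _ hu).trans hl) (by rw [hm.suc _ hu, hs]; rfl)
  | app hu hl har hlen _ ih =>
    have hs := hm.suc _ hu
    refine .app (hm.maps _ hu) ((hm.lab _ hu).trans hl) (by simpa [hs] using har)
      (by simpa [hs] using hlen) ?_
    intro i v t hv ht
    rw [hs, List.getElem?_map, Option.map_eq_some_iff] at hv
    obtain ⟨v, hv, rfl⟩ := hv
    exact ih i v t hv ht

theorem IsGeMorph.rep_of_rep (hm : IsGeMorph S T m)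
    (hc : ∀ u ∈ S.nodes, ∀ v ∈ S.suc u, v ∈ S.nodes) {b : ℕ} {t : Tm F V}
    (h : Rep ar T b t) {u : ℕ} (hu : u ∈ S.nodes) (hb : m u = b) : Rep ar S u t := by
  induction h generalizing u with
  | var _ hl hs =>
    subst hb
    refine .var hu ((hm.lab u hu).symm.trans hl) ?_
    rw [hm.suc u hu] at hs
    exact List.map_eq_nil_iff.1 hs
  | app _ hl har hlen _ ih =>
    subst hb
    have hs := hm.suc u hu
    refine .app hu ((hm.lab u hu).symm.trans hl) (by simpa [hs] using har)
      (by simpa [hs] using hlen) ?_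
    intro i v t hv ht
    refine ih i (m v) t ?_ ht (hc u hu v (List.mem_of_getElem? hv)) rfl
    rw [hs, List.getElem?_map, hv]
    rfl

theorem IsGeMorph.rep_root (hm : IsGeMorph S T m) {t : Tm F V} (h : Rep ar S S.root t) :
    Rep ar T T.root t := by
  have := hm.rep h
  rwa [hm.root] at this

end Morphism

end TermGraph

section Replacement

/-- `ReplAt p s t s' t'`: the term `s` has the subterm `s'` at position `p`, and `t` is
obtained from `s` by replacing this occurrence by `t'`. -/
inductive ReplAt : List ℕ → Tm F V → Tm F V → Tm F V → Tm F V → Prop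
  | nil (s t : Tm F V) : ReplAt [] s t s t
  | cons {i : ℕ} {p : List ℕ} {f : F} {ts : List (Tm F V)} {a a' s' t' : Tm F V} :
      ts[i]? = some a → ReplAt p a a' s' t' →
      ReplAt (i :: p) (Tm.app f ts) (Tm.app f (ts.set i a')) s' t'

theorem RewriteAt.exists_replAt {R : Set (Tm F V × Tm F V)} {p : List ℕ} {s t : Tm F V}
    (h : RewriteAt R p s t) :
    ∃ l r σ, (l, r) ∈ R ∧ ReplAt p s t (substTm σ l) (substTm σ r) := by
  induction h with
  | @root l r σ h => exact ⟨l, r, σ, h, .nil _ _⟩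
  | congr hi _ ih =>
    obtain ⟨l, r, σ, h, h'⟩ := ih
    exact ⟨l, r, σ, h, .cons hi h'⟩

theorem substTm_app (σ : V → Tm F V) (f : F) (ts : List (Tm F V)) :
    substTm σ (Tm.app f ts) = Tm.app f (ts.map (substTm σ)) := by
  simp [substTm]

theorem substTm_var (σ : V → Tm F V) (x : V) : substTm σ (Tm.var x) = σ x := by
  simp [substTm]

variable {ar : F → ℕ} {G : PreGraph (F ⊕ V)}

theorem ReplAt.exists_reachesP {p : List ℕ} {s t s' t' : Tm F V} (h : ReplAt p s t s' t')
    {u : ℕ} (hu : Rep ar G u s) : ∃ w, ReachesP G u p w ∧ Rep ar G w s' := by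
  induction h generalizing u with
  | nil => exact ⟨u, .nil u, hu⟩
  | @cons i p f ts a a' s' t' hi _ ih =>
    cases hu with
    | app hu _ _ hlen hsub =>
      obtain ⟨hlt, -⟩ := List.getElem?_eq_some_iff.1 hi
      have hlt' := hlen ▸ hlt
      have hv := List.getElem?_eq_getElem hlt'
      obtain ⟨w, h1, h2⟩ := ih (hsub i _ _ hv hi)
      exact ⟨w, .cons hu hv h1, h2⟩

/-- Matching: following a position of a pattern in a graph representing an instance. -/
theorem ReachesP.matching {Lg : PreGraph (F ⊕ V)} {σ : V → Tm F V} {a c b : ℕ} {q : List ℕ}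
    {l : Tm F V} (h : ReachesP Lg a q c) (ha : Rep ar Lg a l) (hb : Rep ar G b (substTm σ l)) :
    ∃ d l', ReachesP G b q d ∧ Rep ar Lg c l' ∧ Rep ar G d (substTm σ l') := by
  induction h generalizing b l with
  | nil => exact ⟨b, l, .nil b, ha, hb⟩
  | @cons u v w i p hu hi _ ih =>
    cases ha with
    | var _ _ hs => rw [hs] at hi; cases hi
    | @app _ f ts _ _ har hlen hsub =>
      rw [substTm_app] at hb
      cases hb with
      | app hb _ har' hlen' hsub' =>
        obtain ⟨hlt, -⟩ := List.getElem?_eq_some_iff.1 hi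
        have h1 : i < ts.length := hlen ▸ hlt
        have h2 : i < (G.suc b).length := by rw [har', ← har]; exact hlt
        have h3 := List.getElem?_eq_getElem h1
        have h4 := List.getElem?_eq_getElem h2
        obtain ⟨d, l', h5, h6, h7⟩ := ih (hsub i _ _ hi h3)
          (hsub' i _ _ h4 (by rw [List.getElem?_map, h3]; rfl))
        exact ⟨d, l', .cons hb h4 h5, h6, h7⟩

end Replacement

section Unfolding

variable {ar : F → ℕ} {S : PreGraph (F ⊕ V)}

/-- Unfolding of the `i`-th successor `x` of `a`: this edge is redirected to a copy `n` of `x`. -/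
def unfoldEdge (S : PreGraph (F ⊕ V)) (a i x n : ℕ) : PreGraph (F ⊕ V) where
  nodes := insert n S.nodes
  suc := fun y => if y = n then S.suc x else if y = a then (S.suc a).set i n else S.suc y
  lab := fun y => if y = n then S.lab x else S.lab y
  root := S.root

theorem unfoldEdge_isGeMorph (hS : IsTermGraph ar S) {a i x n : ℕ} (ha : a ∈ S.nodes)
    (hx : (S.suc a)[i]? = some x) (hn : n ∉ S.nodes) :
    IsGeMorph (unfoldEdge S a i x n) S (fun y => if y = n then x else y) := by
  have hxS : x ∈ S.nodes := hS.closed a ha x (List.mem_of_getElem? hx)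
  have hid : ∀ y ∈ S.nodes, (S.suc y).map (fun y => if y = n then x else y) = S.suc y := by
    intro y hy
    conv_rhs => rw [← List.map_id (S.suc y)]
    apply List.map_congr_left
    intro z hz
    have : z ≠ n := fun h => hn (h ▸ hS.closed y hy z hz)
    simp [this]
  constructor
  · intro y hy
    by_cases h : y = n
    · simpa [h] using hxS
    · simpa [h, unfoldEdge] using hy
  · have : S.root ≠ n := fun h => hn (h ▸ hS.rootMem)
    simp [unfoldEdge, this]
  · intro y hy
    by_cases h : y = n <;> simp [h, unfoldEdge]
  · intro y hy
    by_cases h : y = n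
    · simp only [h, unfoldEdge, if_true]
      exact (hid x hxS).symm
    · have hyS : y ∈ S.nodes := by simpa [h, unfoldEdge] using hy
      by_cases h' : y = a
      · subst h'
        simp only [h, unfoldEdge, if_true, if_false]
        rw [List.map_set, hid y hyS, if_pos rfl]
        obtain ⟨hlt, hget⟩ := List.getElem?_eq_some_iff.1 hx
        rw [← hget, List.set_getElem_self]
      · simp only [h, h', unfoldEdge, if_false]
        exact (hid y hyS).symm

theorem exists_unfoldAboveTG [Inhabited V] (hS : IsTermGraph ar S) {p q : List ℕ} {a i x : ℕ}
    (hqp : q ++ [i] <+: p) (haq : IsPos S a q) (hq : UnsharedAt S q)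
    (hx : (S.suc a)[i]? = some x) (hxv : ¬ IsVarNode S x) (hsh : ¬ UnsharedAt S (q ++ [i])) :
    ∃ T, IsTermGraph ar T ∧ UnfoldAboveTG ar p S T ∧ UnsharedAt T (q ++ [i]) := by
  obtain ⟨n, hfresh⟩ : ∃ n, ∀ y ∈ S.nodes, y < n :=
    ⟨S.nodes.sup id + 1, fun y hy => Nat.lt_succ_of_le (Finset.le_sup (f := id) hy)⟩
  have hn : n ∉ S.nodes := fun h => lt_irrefl _ (hfresh n h)
  have ha : a ∈ S.nodes := hS.isPos_mem haq
  have hxa : x ∈ S.suc a := List.mem_of_getElem? hx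
  have hxS : x ∈ S.nodes := hS.closed a ha x hxa
  have hxn : x ≠ n := fun h => hn (h ▸ hxS)
  have han : a ≠ n := fun h => hn (h ▸ ha)
  have hax : a ≠ x := hS.acyclic a x (.single ⟨ha, hxa⟩)
  have hm := unfoldEdge_isGeMorph hS ha hx hn
  set T := unfoldEdge S a i x n with hT
  have hTn : n ∈ T.nodes := Finset.mem_insert_self _ _
  have hTS : ∀ y ∈ S.nodes, y ∈ T.nodes := fun y hy => Finset.mem_insert_of_mem hy
  have hclosed : ∀ u ∈ T.nodes, ∀ v ∈ T.suc u, v ∈ T.nodes := by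
    intro u hu v hv
    by_cases h : u = n
    · simp only [hT, unfoldEdge, h, if_true] at hv
      exact hTS v (hS.closed x hxS v hv)
    · have huS : u ∈ S.nodes := by simpa [h, hT, unfoldEdge] using hu
      by_cases h' : u = a
      · simp only [hT, unfoldEdge, h', han, if_true, if_false] at hv
        rcases List.mem_or_eq_of_mem_set hv with hv | rfl
        · exact hTS v (hS.closed a ha v hv)
        · exact hTn
      · simp only [hT, unfoldEdge, h, h', if_false] at hv
        exact hTS v (hS.closed u huS v hv)
  have hposn : ∀ r, IsPos T n r → r = q ++ [i] := by
    intro r hr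
    rcases List.eq_nil_or_concat' r with rfl | ⟨r', j, rfl⟩
    · have : n = S.root := hr.eq_root
      exact absurd (this ▸ hS.rootMem) hn
    · obtain ⟨z, h1, h2⟩ := ReachesP.split hr
      obtain ⟨hz, h3⟩ := reachesP_singleton.1 h2
      by_cases h : z = n
      · simp only [hT, unfoldEdge, h, if_true] at h3
        exact absurd (hS.closed x hxS n (List.mem_of_getElem? h3)) hn
      · have hzS : z ∈ S.nodes := by simpa [h, hT, unfoldEdge] using hz
        by_cases h' : z = a
        · subst h'
          simp only [hT, unfoldEdge, h, if_true, if_false] at h3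
          have hzpos := hm.isPos h1
          rw [if_neg han] at hzpos
          by_cases hji : j = i
          · rw [hq z r' haq hzpos, hji]
          · rw [List.getElem?_set_ne (Ne.symm hji)] at h3
            exact absurd (hS.closed z hzS n (List.mem_of_getElem? h3)) hn
        · simp only [hT, unfoldEdge, h, h', if_false] at h3
          exact absurd (hS.closed z hzS n (List.mem_of_getElem? h3)) hn
  have hlift : ∀ {b r}, IsPos S b r → ∃ c, IsPos T c r ∧ (if c = n then x else c) = b :=
    fun h => hm.lift_isPos hclosed (hTS _ hS.rootMem) h
  have hnpos : IsPos T n (q ++ [i]) := by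
    obtain ⟨c, hc1, hc2⟩ := hlift haq
    by_cases h : c = n
    · rw [if_pos h] at hc2
      exact absurd hc2.symm hax
    · rw [if_neg h] at hc2
      subst hc2
      refine ReachesP.append hc1 (reachesP_singleton.2 ⟨hTS c ha, ?_⟩)
      simp only [hT, unfoldEdge, h, if_true, if_false]
      exact List.getElem?_set_self (List.getElem?_eq_some_iff.1 hx).1
  have hxpos : IsPos S x (q ++ [i]) :=
    ReachesP.append haq (reachesP_singleton.2 ⟨ha, hx⟩)
  have hT' : IsTermGraph ar T := by
    refine isTermGraph_of_rep (hTS _ hS.rootMem) ?_ ?_ ?_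
    · intro y hy
      by_cases h : y = n
      · subst h; exact hnpos.reach
      have hyS : y ∈ S.nodes := by simpa [h, hT, unfoldEdge] using hy
      by_cases h' : y = x
      · subst h'
        unfold UnsharedAt at hsh
        push Not at hsh
        obtain ⟨w, r, hw1, hw2, hr⟩ := hsh
        obtain rfl := ReachesP.unique hxpos hw1
        obtain ⟨c, hc1, hc2⟩ := hlift hw2
        by_cases hc : c = n
        · subst hc; exact absurd (hposn r hc1) hr
        · rw [if_neg hc] at hc2
          subst hc2
          exact hc1.reach
      · obtain ⟨r, hr⟩ := hS.exists_isPos hyS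
        obtain ⟨c, hc1, hc2⟩ := hlift hr
        by_cases hc : c = n
        · rw [if_pos hc] at hc2
          exact absurd hc2.symm h'
        · rw [if_neg hc] at hc2
          subst hc2
          exact hc1.reach
    · intro y hy
      obtain ⟨t, ht⟩ := hS.exists_rep (hm.maps y hy)
      exact ⟨t, hm.rep_of_rep hclosed ht hy rfl⟩
    · have hlab : ∀ y ∈ T.nodes, ∀ z, T.lab y = Sum.inr z → y ∈ S.nodes ∧ S.lab y = Sum.inr z := by
        intro y hy z hz
        by_cases h : y = n
        · simp only [hT, unfoldEdge, h, if_true] at hz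
          exact absurd ⟨z, hz⟩ hxv
        · simp only [hT, unfoldEdge, h, if_false] at hz
          exact ⟨by simpa [h, hT, unfoldEdge] using hy, hz⟩
      intro y hy y' hy' z hz hz'
      obtain ⟨h1, h2⟩ := hlab y hy z hz
      obtain ⟨h3, h4⟩ := hlab y' hy' z hz'
      exact hS.varShared y h1 y' h3 z h2 h4
  refine ⟨T, hT', ⟨hS, hT', n, x, ⟨⟨hTn, hTS x hxS, (hfresh x hxS).le, hm⟩, hxn.symm⟩,
    q ++ [i], hqp, ?_⟩, ?_⟩
  · intro r
    exact ⟨hposn r, fun h => h ▸ hnpos⟩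
  · intro w r hw hr
    obtain rfl := ReachesP.unique hnpos hw
    exact hposn r hr

theorem not_unfoldAboveTG {U : PreGraph (F ⊕ V)} {p : List ℕ} {w : ℕ}
    (hw : IsPos U w p) (hp : UnsharedAt U p) (c : PreGraph (F ⊕ V)) :
    ¬ UnfoldAboveTG ar p U c := by
  rintro ⟨hU, hc, u, v, ⟨⟨hu, hv, -, hm⟩, huv⟩, q, ⟨q', rfl⟩, hq⟩
  have h1 := hm.isPos ((hq q).2 rfl)
  rw [if_pos rfl] at h1
  obtain ⟨r, hr⟩ := hc.exists_isPos hv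
  have h2 := hm.isPos hr
  rw [if_neg huv.symm] at h2
  obtain ⟨z, h3, h4⟩ := ReachesP.split hw
  obtain rfl := ReachesP.unique h1 h3
  have h5 : r ++ q' = q ++ q' := hp w _ hw (ReachesP.append h2 h4)
  rw [List.append_cancel_right h5] at hr
  exact huv (ReachesP.unique ((hq q).2 rfl) hr)

theorem exists_normTo_unfoldAboveTG [Inhabited V] (hS : IsTermGraph ar S) {p : List ℕ}
    {s t s' t' : Tm F V} (hs : Rep ar S S.root s) (hrepl : ReplAt p s t s' t')
    (hs' : ∀ x, s' ≠ Tm.var x) :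
    ∃ U, IsTermGraph ar U ∧ Rep ar U U.root s ∧ UnsharedAt U p ∧
      NormTo (UnfoldAboveTG ar p) S U := by
  have key : ∀ q, q <+: p → ∃ U, IsTermGraph ar U ∧ Rep ar U U.root s ∧ UnsharedAt U q ∧
      Relation.ReflTransGen (UnfoldAboveTG ar p) S U := by
    intro q
    induction q using List.reverseRecOn with
    | nil =>
      intro _
      refine ⟨S, hS, hs, ?_, .refl⟩
      intro w q hw hq
      obtain rfl := hw.eq_root
      exact hS.eq_nil_of_reachesP_self hq
    | append_singleton q i ih =>
      intro hqp
      obtain ⟨U, hU, hUs, hUq, hSU⟩ := ih ((List.prefix_append q [i]).trans hqp)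
      by_cases hsh : UnsharedAt U (q ++ [i])
      · exact ⟨U, hU, hUs, hsh, hSU⟩
      obtain ⟨w, hw, hws⟩ := hrepl.exists_reachesP hUs
      obtain ⟨q', rfl⟩ := hqp
      obtain ⟨x, hx1, hx2⟩ := hw.split
      obtain ⟨a, ha1, ha2⟩ := hx1.split
      obtain ⟨ha, hx⟩ := reachesP_singleton.1 ha2
      have hxv : ¬ IsVarNode U x := by
        rintro ⟨y, hy⟩
        cases hx2 with
        | nil =>
          cases hws with
          | var => exact hs' _ rfl
          | app _ hl => rw [hy] at hl; cases hl
        | cons hxU hi _ => rw [hU.varSuc x hxU y hy] at hi; cases hi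
      obtain ⟨T, hT, hUT, hTq⟩ := exists_unfoldAboveTG hU (List.prefix_append _ q') ha1 hUq hx
        hxv hsh
      refine ⟨T, hT, ?_, hTq, hSU.tail hUT⟩
      obtain ⟨-, -, u, v, ⟨⟨-, -, -, hm⟩, -⟩, -⟩ := hUT
      have h := hT.rep_termOf
      rwa [(hm.rep_root h).unique hUs] at h
  obtain ⟨U, hU, hUs, hUp, hSU⟩ := key p (List.prefix_refl p)
  obtain ⟨w, hw, -⟩ := hrepl.exists_reachesP hUs
  exact ⟨U, hU, hUs, hUp, hSU, not_unfoldAboveTG hw hUp⟩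

end Unfolding

section Folding

variable {ar : F → ℕ} {S T : PreGraph (F ⊕ V)}

theorem CollapseS.card_lt (hS : IsTermGraph ar S) (hT : IsTermGraph ar T) {u v : ℕ}
    (h : CollapseS S T u v) : T.nodes.card < S.nodes.card := by
  obtain ⟨⟨hu, hv, -, hm⟩, huv⟩ := h
  have hsub : T.nodes ⊆ S.nodes.erase u := by
    intro b hb
    obtain ⟨r, hr⟩ := hT.exists_isPos hb
    obtain ⟨c, hc, rfl⟩ := hm.lift_isPos hS.closed hS.rootMem hr
    by_cases h : c = u
    · rw [if_pos h]
      exact Finset.mem_erase.2 ⟨huv.symm, hv⟩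
    · rw [if_neg h]
      exact Finset.mem_erase.2 ⟨h, hS.isPos_mem hc⟩
  exact lt_of_le_of_lt (Finset.card_le_card hsub) (Finset.card_erase_lt_of_mem hu)

theorem FoldBelowTG.unsharedAt {p : List ℕ} (h : FoldBelowTG ar p S T) (hp : UnsharedAt S p) :
    UnsharedAt T p := by
  obtain ⟨hS, hT, u, v, ⟨⟨hu, hv, -, hm⟩, huv⟩, hub, hvb⟩ := h
  have hb : ∀ {w}, IsPos S w p → ¬ StrictlyBelow S p w := by
    rintro w hw ⟨q, hq, -, hne⟩
    exact hne (hp w q hw hq).symm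
  intro w q hw hq
  obtain ⟨w₀, h0, rfl⟩ := hm.lift_isPos hS.closed hS.rootMem hw
  obtain ⟨w₁, h1, h01⟩ := hm.lift_isPos hS.closed hS.rootMem hq
  have hu0 : w₀ ≠ u := fun h => hb h0 (h ▸ hub)
  have hv0 : w₀ ≠ v := fun h => hb h0 (h ▸ hvb)
  have h01' : w₁ = w₀ := by
    rw [if_neg hu0] at h01
    by_cases h : w₁ = u
    · rw [if_pos h] at h01
      exact absurd h01.symm hv0
    · rwa [if_neg h] at h01
  exact hp w₀ q h0 (h01' ▸ h1)

theorem exists_normTo_foldBelowTG {p : List ℕ} {s : Tm F V} (hS : IsTermGraph ar S)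
    (hs : Rep ar S S.root s) (hp : UnsharedAt S p) :
    ∃ T, IsTermGraph ar T ∧ Rep ar T T.root s ∧ UnsharedAt T p ∧
      NormTo (FoldBelowTG ar p) S T := by
  induction hn : S.nodes.card using Nat.strong_induction_on generalizing S with
  | _ n ih =>
    by_cases h : ∃ c, FoldBelowTG ar p S c
    · obtain ⟨c, hc⟩ := h
      have hc' := hc
      obtain ⟨-, hcT, u, v, hcol, -⟩ := hc'
      obtain ⟨T, hT, hTs, hTp, hcT, hmin⟩ := ih _ (hn ▸ hcol.card_lt hS hcT) hcT
        (hcol.1.2.2.2.rep_root hs) (hc.unsharedAt hp) rfl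
      exact ⟨T, hT, hTs, hTp, .head hc hcT, hmin⟩
    · exact ⟨S, hS, hs, hp, .refl, fun c hc => h ⟨c, hc⟩⟩

theorem redirect_isGeMorph {d d' : ℕ}
    (hlab : S.lab d' = S.lab d) (hsuc : S.suc d' = S.suc d) :
    IsGeMorph S (redirect S d d') (fun w => if w = d then d' else w) := by
  constructor
  · intro w hw
    by_cases h : w = d <;> simp [redirect, h, hw]
  · rfl
  · intro w hw
    by_cases h : w = d <;> simp [redirect, h, hlab]
  · intro w hw
    by_cases h : w = d <;> simp [redirect, h, hsuc]

theorem isTermGraph_redirect [Inhabited V] (hS : IsTermGraph ar S) {d d' : ℕ}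
    (hd' : d' ∈ S.nodes) (hne : d ≠ d')
    (hlab : S.lab d' = S.lab d) (hsuc : S.suc d' = S.suc d) :
    IsTermGraph ar (redirect S d d') := by
  have hm := redirect_isGeMorph hlab hsuc
  have hmem : ∀ w ∈ (redirect S d d').nodes, w ∈ S.nodes ∧ w ≠ d := by
    intro w hw
    rcases Finset.mem_insert.1 hw with rfl | hw
    · exact ⟨hd', hne.symm⟩
    · exact ⟨Finset.mem_of_mem_erase hw, Finset.ne_of_mem_erase hw⟩
  refine isTermGraph_of_rep ?_ ?_ ?_ ?_
  · exact hm.root ▸ hm.maps _ hS.rootMem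
  · intro w hw
    obtain ⟨hwS, hwd⟩ := hmem w hw
    obtain ⟨r, hr⟩ := hS.exists_isPos hwS
    have := hm.isPos hr
    rw [if_neg hwd] at this
    exact this.reach
  · intro w hw
    obtain ⟨hwS, hwd⟩ := hmem w hw
    obtain ⟨t, ht⟩ := hS.exists_rep hwS
    have := hm.rep ht
    rw [if_neg hwd] at this
    exact ⟨t, this⟩
  · intro w hw w' hw'
    exact hS.varShared w (hmem w hw).1 w' (hmem w' hw').1

theorem StrictlyBelow.edge {p : List ℕ} {u v i : ℕ} (h : StrictlyBelow S p u)
    (hu : u ∈ S.nodes) (hi : (S.suc u)[i]? = some v) : StrictlyBelow S p v := by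
  obtain ⟨q, hq, hpq, hne⟩ := h
  refine ⟨q ++ [i], ReachesP.append hq (reachesP_singleton.2 ⟨hu, hi⟩),
    hpq.trans (List.prefix_append q [i]), ?_⟩
  rintro rfl
  have := hpq.length_le
  simp at this

/-- Strictly below `p`, graphs that cannot be folded are maximally sharing. -/
theorem eq_of_rep_of_not_foldBelowTG [Inhabited V] {p : List ℕ} (hS : IsTermGraph ar S)
    (hmin : ∀ c, ¬ FoldBelowTG ar p S c) {d d' : ℕ} {t : Tm F V}
    (hd : Rep ar S d t) (hd' : Rep ar S d' t) (hb : StrictlyBelow S p d)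
    (hb' : StrictlyBelow S p d') : d = d' := by
  induction hd generalizing d' with
  | @var d x hd hl hs =>
    cases hd' with
    | var hd' hl' hs' => exact hS.varShared d hd d' hd' x hl hl'
  | @app d f ts hd hl har hlen hsub ih =>
    cases hd' with
    | app hd' hl' har' hlen' hsub' =>
      have hsuc : S.suc d = S.suc d' := by
        apply List.ext_getElem (har.trans har'.symm)
        intro i h1 h2
        have h3 : i < ts.length := hlen ▸ h1
        have e1 := List.getElem?_eq_getElem h1
        have e2 := List.getElem?_eq_getElem h2
        have e3 := List.getElem?_eq_getElem h3
        exact ih i _ _ e1 e3 (hsub' i _ _ e2 e3) (hb.edge hd e1) (hb'.edge hd' e2)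
      have hlab : S.lab d = S.lab d' := hl.trans hl'.symm
      by_contra hne
      rcases Nat.le_total d d' with hle | hle
      · exact hmin _ ⟨hS, isTermGraph_redirect hS hd (Ne.symm hne) hlab hsuc, d', d,
          ⟨⟨hd', hd, hle, redirect_isGeMorph hlab hsuc⟩, Ne.symm hne⟩, hb', hb⟩
      · exact hmin _ ⟨hS, isTermGraph_redirect hS hd' hne hlab.symm hsuc.symm, d, d',
          ⟨⟨hd, hd', hle, redirect_isGeMorph hlab.symm hsuc.symm⟩, hne⟩, hb, hb'⟩

end Folding

section Step

variable {ar : F → ℕ} {S K : PreGraph (F ⊕ V)} {u h : ℕ}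

/-- `K` contains the nodes of `S` except `u`, which is replaced by `h`. -/
def ContainsRedirected (S K : PreGraph (F ⊕ V)) (u h : ℕ) : Prop :=
  ∀ w ∈ S.nodes, w ≠ u → w ∈ K.nodes ∧ K.lab w = S.lab w ∧
    K.suc w = (S.suc w).map fun x => if x = u then h else x

theorem ContainsRedirected.rep_of_not_reach (hK : ContainsRedirected S K u h) {w : ℕ}
    {t : Tm F V} (ht : Rep ar S w t) (hw : ¬ Reach S w u) : Rep ar K w t := by
  induction ht with
  | var hwS hl hs =>
    obtain ⟨h1, h2, h3⟩ := hK _ hwS (fun e => hw (.of_eq e))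
    exact .var h1 (h2.trans hl) (by rw [h3, hs]; rfl)
  | app hwS hl har hlen _ ih =>
    obtain ⟨h1, h2, h3⟩ := hK _ hwS (fun e => hw (.of_eq e))
    refine .app h1 (h2.trans hl) (by simpa [h3] using har) (by simpa [h3] using hlen) ?_
    intro i v t hv ht
    rw [h3, List.getElem?_map, Option.map_eq_some_iff] at hv
    obtain ⟨v', hv', rfl⟩ := hv
    have hnr : ¬ Reach S v' u := fun hr => hw (.head ⟨hwS, List.mem_of_getElem? hv'⟩ hr)
    rw [if_neg (fun e => hnr (.of_eq e))]
    exact ih i v' t hv' ht hnr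

theorem ContainsRedirected.exists_rep (hK : ContainsRedirected S K u h) {r : Tm F V}
    (hh : Rep ar K h r) {w : ℕ} {t : Tm F V} (ht : Rep ar S w t) :
    ∃ t', Rep ar K (if w = u then h else w) t' := by
  induction ht with
  | @var w x hwS hl hs =>
    by_cases e : w = u
    · exact ⟨r, by rwa [if_pos e]⟩
    rw [if_neg e]
    obtain ⟨h1, h2, h3⟩ := hK w hwS e
    exact ⟨_, .var h1 (h2.trans hl) (by rw [h3, hs]; rfl)⟩
  | @app w f ts hwS hl har hlen _ ih =>
    by_cases e : w = u
    · exact ⟨r, by rwa [if_pos e]⟩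
    rw [if_neg e]
    obtain ⟨h1, h2, h3⟩ := hK w hwS e
    have hex : ∀ v : ℕ, ∃ t', v ∈ K.suc w → Rep ar K v t' := by
      intro v
      by_cases hv : v ∈ K.suc w
      · rw [h3] at hv
        obtain ⟨v', hv', rfl⟩ := List.mem_map.1 hv
        obtain ⟨i, hi⟩ := List.mem_iff_getElem?.1 hv'
        obtain ⟨hlt, -⟩ := List.getElem?_eq_some_iff.1 hi
        have hlt' : i < ts.length := hlen ▸ hlt
        obtain ⟨t', ht'⟩ := ih i v' _ hi (List.getElem?_eq_getElem hlt')
        exact ⟨t', fun _ => ht'⟩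
      · exact ⟨r, fun hv' => absurd hv' hv⟩
    choose τ hτ using hex
    refine ⟨Tm.app f ((K.suc w).map τ), .app h1 (h2.trans hl) (by simpa [h3] using har)
      (by simp) ?_⟩
    intro i v t hv ht
    rw [List.getElem?_map, hv] at ht
    cases ht
    exact hτ v (List.mem_of_getElem? hv)

theorem ContainsRedirected.rep_replAt (hK : ContainsRedirected S K u h) {p : List ℕ}
    {s t s' t' : Tm F V} (hrepl : ReplAt p s t s' t') (hh : Rep ar K h t') {a : ℕ}
    (ha : Rep ar S a s) (hp : ReachesP S a p u) (huniq : ∀ q, ReachesP S a q u → q = p) :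
    Rep ar K (if a = u then h else a) t := by
  induction hrepl generalizing a with
  | nil =>
    cases hp
    rwa [if_pos rfl]
  | @cons i p f ts b b' s' t' hi _ ih =>
    have hau : a ≠ u := by
      rintro rfl
      exact absurd (huniq [] (.nil a)) (by simp)
    rw [if_neg hau]
    cases ha with
    | app haS hl har hlen hsub =>
      obtain ⟨h1, h2, h3⟩ := hK a haS hau
      refine .app h1 (h2.trans hl) (by simpa [h3] using har) (by simpa [h3] using hlen) ?_
      intro j v t hv ht
      rw [h3, List.getElem?_map, Option.map_eq_some_iff] at hv
      obtain ⟨v', hv', rfl⟩ := hv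
      by_cases hji : j = i
      · subst hji
        rw [List.getElem?_set_self (List.getElem?_eq_some_iff.1 hi).1] at ht
        cases ht
        refine ih hh (hsub j v' b hv' hi) ?_ ?_
        · cases hp with
          | cons _ hv'' hp =>
            rw [hv'] at hv''
            cases hv''
            exact hp
        · intro q hq
          exact (List.cons.inj (huniq (j :: q) (.cons haS hv' hq))).2
      · rw [List.getElem?_set_ne (Ne.symm hji)] at ht
        have hnr : ¬ Reach S v' u := by
          intro hr
          obtain ⟨q, hq⟩ := exists_reachesP_of_reach hr
          exact hji (List.cons.inj (huniq (j :: q) (.cons haS hv' hq))).1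
        rw [if_neg (fun e => hnr (.of_eq e))]
        exact hK.rep_of_not_reach (hsub j v' t hv' ht) hnr

/-- Instantiating a right-hand side `Rg` inside `K`. -/
theorem rep_substTm {Rg : PreGraph (F ⊕ V)} {σ : V → Tm F V} {ψ : ℕ → ℕ}
    (hvar : ∀ y ∈ Rg.nodes, ∀ x, Rg.lab y = Sum.inr x → Rep ar K (ψ y) (σ x))
    (hfun : ∀ y ∈ Rg.nodes, ∀ f, Rg.lab y = Sum.inl f →
      ψ y ∈ K.nodes ∧ K.lab (ψ y) = Sum.inl f ∧ K.suc (ψ y) = (Rg.suc y).map ψ)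
    {y : ℕ} {r : Tm F V} (hy : Rep ar Rg y r) : Rep ar K (ψ y) (substTm σ r) := by
  induction hy with
  | var hy hl _ =>
    rw [substTm_var]
    exact hvar _ hy _ hl
  | app hy hl har hlen _ ih =>
    obtain ⟨h1, h2, h3⟩ := hfun _ hy _ hl
    rw [substTm_app]
    refine .app h1 h2 (by simpa [h3] using har) (by simpa [h3] using hlen) ?_
    intro i v t hv ht
    rw [h3, List.getElem?_map, Option.map_eq_some_iff] at hv
    obtain ⟨v', hv', rfl⟩ := hv
    rw [List.getElem?_map, Option.map_eq_some_iff] at ht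
    obtain ⟨t', ht', rfl⟩ := ht
    exact ih i v' t' hv' ht'

/-- If the nodes strictly below `u` are maximally shared, a pattern graph representing `l`
maps into a graph in which `u` represents an instance of `l`. -/
theorem exists_matching_map [Inhabited V] {Lg : PreGraph (F ⊕ V)} (hL : IsTermGraph ar Lg)
    {σ : V → Tm F V} (hu : Rep ar S u (substTm σ (termOf Lg)))
    (hmax : ∀ q q' d d' t, q ≠ [] → q' ≠ [] → ReachesP S u q d → ReachesP S u q' d' →
      Rep ar S d t → Rep ar S d' t → d = d') :
    ∃ μ : ℕ → ℕ, ∀ a ∈ Lg.nodes, (∀ q, IsPos Lg a q → ReachesP S u q (μ a)) ∧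
      ∃ l, Rep ar Lg a l ∧ Rep ar S (μ a) (substTm σ l) := by
  have hex : ∀ a, ∃ b, a ∈ Lg.nodes → (∀ q, IsPos Lg a q → ReachesP S u q b) ∧
      ∃ l, Rep ar Lg a l ∧ Rep ar S b (substTm σ l) := by
    intro a
    by_cases ha : a ∈ Lg.nodes
    · obtain ⟨q₀, h0⟩ := hL.exists_isPos ha
      obtain ⟨d, l, hd, hl, hdl⟩ := ReachesP.matching h0 hL.rep_termOf hu
      refine ⟨d, fun _ => ⟨?_, l, hl, hdl⟩⟩
      intro q hq
      obtain ⟨d', l', hd', hl', hdl'⟩ := ReachesP.matching hq hL.rep_termOf hu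
      obtain rfl := hl.unique hl'
      by_cases e : q₀ = []
      · subst e
        cases h0
        obtain rfl := hL.eq_nil_of_reachesP_self hq
        exact hd
      by_cases e' : q = []
      · subst e'
        cases hq
        exact absurd (hL.eq_nil_of_reachesP_self h0) e
      rw [hmax q₀ q d d' _ e e' hd hd' hdl hdl']
      exact hd'
    · exact ⟨0, fun h => absurd h ha⟩
  choose μ hμ using hex
  exact ⟨μ, hμ⟩

/-- The isomorphic copy of `G` with all nodes shifted by `n`. -/
def shift (n : ℕ) (G : PreGraph (F ⊕ V)) : PreGraph (F ⊕ V) where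
  nodes := G.nodes.image (· + n)
  suc := fun w => (G.suc (w - n)).map (· + n)
  lab := fun w => G.lab (w - n)
  root := G.root + n

theorem gIsoOn_shift (n : ℕ) (G : PreGraph (F ⊕ V)) : GIsoOn (· + n) G (shift n G) where
  nodes := rfl
  root := rfl
  lab u _ := by simp [shift]
  suc u _ := by simp [shift]

theorem mem_shift {n : ℕ} {G : PreGraph (F ⊕ V)} {y : ℕ} :
    y + n ∈ (shift n G).nodes ↔ y ∈ G.nodes := by
  simp [shift]

theorem isMorphism_shift [Inhabited V] {Lg : PreGraph (F ⊕ V)} (hL : IsTermGraph ar Lg)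
    {σ : V → Tm F V} {μ : ℕ → ℕ} (n : ℕ)
    (hμ : ∀ a ∈ Lg.nodes, (∀ q, IsPos Lg a q → ReachesP S u q (μ a)) ∧
      ∃ l, Rep ar Lg a l ∧ Rep ar S (μ a) (substTm σ l)) :
    IsMorphism (shift n Lg) (subgraph S u) (fun w => μ (w - n)) := by
  classical
  have hall : ∀ {P : ℕ → Prop}, (∀ a ∈ Lg.nodes, P (a + n)) → ∀ w ∈ (shift n Lg).nodes, P w := by
    intro P hP w hw
    obtain ⟨a, ha, rfl⟩ := Finset.mem_image.1 hw
    exact hP a ha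
  have hlab : ∀ a ∈ Lg.nodes, ∀ f, Lg.lab a = Sum.inl f →
      S.lab (μ a) = Sum.inl f ∧ (S.suc (μ a)).length = ar f ∧ μ a ∈ S.nodes := by
    intro a ha f hf
    obtain ⟨-, l, h1, h2⟩ := hμ a ha
    cases h1 with
    | var _ hl => rw [hf] at hl; cases hl
    | app _ hl =>
      rw [hf] at hl
      cases hl
      rw [substTm_app] at h2
      cases h2 with
      | app h1 h2 h3 => exact ⟨h2, h3, h1⟩
  constructor
  · apply hall
    intro a ha
    obtain ⟨h1, l, -, h2⟩ := hμ a ha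
    obtain ⟨q, hq⟩ := hL.exists_isPos ha
    rw [Nat.add_sub_cancel]
    exact Finset.mem_filter.2 ⟨h2.mem, (h1 q hq).reach⟩
  · have h := (hμ _ hL.rootMem).1 [] (.nil _)
    simp only [shift, subgraph, Nat.add_sub_cancel]
    exact (h.unique (.nil u))
  · apply hall
    intro a ha f hf
    simp only [shift, Nat.add_sub_cancel] at hf ⊢
    exact (hlab a ha f hf).1
  · apply hall
    intro a ha f hf
    simp only [shift, Nat.add_sub_cancel] at hf
    simp only [shift, subgraph, Nat.add_sub_cancel, List.map_map]
    obtain ⟨-, hlen, hmem⟩ := hlab a ha f hf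
    have hlen' := hL.funArity a ha f hf
    apply List.ext_getElem
    · simp [hlen, hlen']
    intro i h1 h2
    have h3 : i < (Lg.suc a).length := by simpa using h2
    have e1 := List.getElem?_eq_getElem h1
    have e3 := List.getElem?_eq_getElem h3
    obtain ⟨q, hq⟩ := hL.exists_isPos ha
    have hb := hL.closed a ha _ (List.getElem_mem h3)
    have hpos := (hμ _ hb).1 _ (ReachesP.append hq (reachesP_singleton.2 ⟨ha, e3⟩))
    have hpos' := ((hμ a ha).1 q hq).append (reachesP_singleton.2 ⟨hmem, e1⟩)
    simpa using hpos'.unique hpos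

/-- A graph rewrite step at an unshared node below which the graph is maximally sharing
simulates the corresponding term rewrite step. -/
theorem exists_gStepP [Inhabited V] {R : Set (Tm F V × Tm F V)}
    {G : Set (PreGraph (F ⊕ V) × PreGraph (F ⊕ V))} (hG : IsSimGRS ar R G)
    (hS : IsTermGraph ar S) {p : List ℕ} {s t l r : Tm F V} {σ : V → Tm F V}
    (hs : Rep ar S S.root s) (hlr : (l, r) ∈ R)
    (hrepl : ReplAt p s t (substTm σ l) (substTm σ r)) (hp : UnsharedAt S p)
    (hmin : ∀ c, ¬ FoldBelowTG ar p S c) :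
    ∃ T, IsTermGraph ar T ∧ GStepP G p S T ∧ termOf T = t := by
  classical
  obtain ⟨u, hup, hul⟩ := hrepl.exists_reachesP hs
  obtain ⟨⟨Lg, Rg⟩, hLR, hrule, ⟨hL, -, hLl⟩, ⟨hRg, -, hRr⟩, hcommon⟩ := hG.1 _ hlr
  dsimp only at hrule hL hLl hRg hRr hcommon
  have hmax : ∀ q q' d d' t, q ≠ [] → q' ≠ [] → ReachesP S u q d → ReachesP S u q' d' →
      Rep ar S d t → Rep ar S d' t → d = d' := by
    intro q q' d d' t hq hq' hd hd' ht ht'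
    exact eq_of_rep_of_not_foldBelowTG hS hmin ht ht'
      ⟨p ++ q, ReachesP.append hup hd, List.prefix_append _ _, by simpa using hq⟩
      ⟨p ++ q', ReachesP.append hup hd', List.prefix_append _ _, by simpa using hq'⟩
  subst hLl hRr
  obtain ⟨μ, hμ⟩ := exists_matching_map hL hul hmax
  obtain ⟨n, hfresh⟩ : ∃ n, ∀ y ∈ S.nodes, y < n :=
    ⟨S.nodes.sup id + 1, fun y hy => Nat.lt_succ_of_le (Finset.le_sup (f := id) hy)⟩
  have hn : ∀ y, y + n ∉ S.nodes := fun y h => by have := hfresh _ h; omega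
  set ψ : ℕ → ℕ := fun y => if y ∈ Lg.nodes then μ y else y + n with hψ
  set H := applyMorph (shift n Lg).nodes (fun w => μ (w - n)) S (shift n Rg) with hH
  set K := gUnion H (redirect S u H.root) with hKdef
  have hψ' : ∀ y, (if y + n ∈ (shift n Lg).nodes then μ (y + n - n) else y + n) = ψ y := by
    intro y
    simp only [mem_shift, Nat.add_sub_cancel, hψ]
  have hHroot : H.root = ψ Rg.root := hψ' _
  have hHnodes : ∀ w, w ∈ H.nodes ↔ ∃ y ∈ Rg.nodes, ψ y = w := by
    intro w
    constructor
    · intro hw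
      obtain ⟨_, hw', rfl⟩ := Finset.mem_image.1 hw
      obtain ⟨y, hy, rfl⟩ := Finset.mem_image.1 hw'
      exact ⟨y, hy, (hψ' y).symm⟩
    · rintro ⟨y, hy, rfl⟩
      exact Finset.mem_image.2 ⟨y + n, mem_shift.2 hy, hψ' y⟩
  have hbelow : ∀ y ∈ Rg.nodes, y ∈ Lg.nodes →
      μ y ∈ S.nodes ∧ Relation.TransGen (Edge S) u (μ y) := by
    intro y hyR hyL
    obtain ⟨h1, l, -, h2⟩ := hμ y hyL
    obtain ⟨q, hq⟩ := hL.exists_isPos hyL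
    refine ⟨h2.mem, (h1 q hq).transGen ?_⟩
    rintro rfl
    exact hrule.rootNotInRhs (hq.eq_root ▸ hyR)
  have hnr : ∀ w, Relation.TransGen (Edge S) u w → ¬ Reach S w u :=
    fun w h h' => hS.acyclic u u (h.trans_left h') rfl
  have hvarL : ∀ y ∈ Rg.nodes, ∀ x, Rg.lab y = Sum.inr x → y ∈ Lg.nodes :=
    fun y hy x hx => ((hcommon y).2 ⟨hy, x, hx⟩).1
  have hfunL : ∀ y ∈ Rg.nodes, ∀ f, Rg.lab y = Sum.inl f → y ∉ Lg.nodes := by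
    intro y hy f hf hyL
    obtain ⟨-, x, hx⟩ := (hcommon y).1 ⟨hyL, hy⟩
    rw [hf] at hx
    cases hx
  have hK : ContainsRedirected S K u H.root := by
    intro w hw hwu
    have hwK : w ∈ K.nodes :=
      Finset.mem_union_right _ (Finset.mem_insert_of_mem (Finset.mem_erase.2 ⟨hwu, hw⟩))
    by_cases hwH : w ∈ H.nodes
    · refine ⟨hwK, ?_, ?_⟩
      · simp only [hKdef, gUnion, hwH, if_true]
        simp only [hH, applyMorph, hw, if_true]
      · have e : K.suc w = S.suc w := by
          simp only [hKdef, gUnion, hwH, if_true]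
          simp only [hH, applyMorph, hw, if_true]
        obtain ⟨y, hyR, rfl⟩ := (hHnodes w).1 hwH
        have hyL : y ∈ Lg.nodes := by
          by_contra hyL
          simp only [hψ, hyL, if_false] at hw
          exact hn y hw
        have hψy : ψ y = μ y := by simp only [hψ, hyL, if_true]
        have hnr' := hnr _ (hbelow y hyR hyL).2
        rw [← hψy] at hnr'
        rw [e]
        conv_lhs => rw [← List.map_id (S.suc (ψ y))]
        apply List.map_congr_left
        intro z hz
        have : z ≠ u := by
          rintro rfl
          exact hnr' (.single ⟨hw, hz⟩)
        simp [this]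
    · exact ⟨hwK, by simp [hKdef, gUnion, hwH, redirect], by simp [hKdef, gUnion, hwH, redirect]⟩
  have hvarK : ∀ y ∈ Rg.nodes, ∀ x, Rg.lab y = Sum.inr x → Rep ar K (ψ y) (σ x) := by
    intro y hy x hx
    have hyL := hvarL y hy x hx
    have hψy : ψ y = μ y := by simp only [hψ, hyL, if_true]
    rw [hψy]
    obtain ⟨-, l, h1, h2⟩ := hμ y hyL
    have hlab := (hrule.sharing y hyL hy).1.trans hx
    cases h1 with
    | var _ hl =>
      rw [hlab] at hl
      cases hl
      rw [substTm_var] at h2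
      exact hK.rep_of_not_reach h2 (hnr _ (hbelow y hy hyL).2)
    | app _ hl => rw [hlab] at hl; cases hl
  have hfunK : ∀ y ∈ Rg.nodes, ∀ f, Rg.lab y = Sum.inl f →
      ψ y ∈ K.nodes ∧ K.lab (ψ y) = Sum.inl f ∧ K.suc (ψ y) = (Rg.suc y).map ψ := by
    intro y hy f hf
    have hyL := hfunL y hy f hf
    have hyH : ψ y ∈ H.nodes := (hHnodes _).2 ⟨y, hy, rfl⟩
    have hψy : ψ y = y + n := by simp only [hψ, hyL, if_false]
    refine ⟨Finset.mem_union_left _ hyH, ?_, ?_⟩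
    · simp only [hKdef, gUnion, hyH, if_true]
      simp only [hψy, hH, applyMorph, hn y, if_false, shift, Nat.add_sub_cancel]
      exact hf
    · simp only [hKdef, gUnion, hyH, if_true]
      simp only [hψy, hH, applyMorph, hn y, if_false]
      have : (shift n Rg).suc (y + n) = (Rg.suc y).map (· + n) := by simp [shift]
      rw [this, List.map_map]
      exact List.map_congr_left fun z _ => hψ' z
  have hRrep : ∀ {y r'}, Rep ar Rg y r' → Rep ar K (ψ y) (substTm σ r') :=
    fun h => rep_substTm hvarK hfunK h
  have hroot : Rep ar K H.root (substTm σ (termOf Rg)) := by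
    rw [hHroot]
    exact hRrep hRg.rep_termOf
  have hKmem : ∀ w ∈ K.nodes, (∃ y ∈ Rg.nodes, ψ y = w) ∨ (w ∈ S.nodes ∧ w ≠ u) := by
    intro w hw
    rcases Finset.mem_union.1 hw with hw | hw
    · exact .inl ((hHnodes w).1 hw)
    rcases Finset.mem_insert.1 hw with rfl | hw
    · exact .inl ⟨_, hRg.rootMem, hHroot.symm⟩
    · exact .inr ⟨Finset.mem_of_mem_erase hw, Finset.ne_of_mem_erase hw⟩
  have hKrep : ∀ w ∈ K.nodes, ∃ t, Rep ar K w t := by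
    intro w hw
    rcases hKmem w hw with ⟨y, hy, rfl⟩ | ⟨hwS, hwu⟩
    · obtain ⟨t, ht⟩ := hRg.exists_rep hy
      exact ⟨_, hRrep ht⟩
    · obtain ⟨t, ht⟩ := hS.exists_rep hwS
      have := hK.exists_rep hroot ht
      rwa [if_neg hwu] at this
  have hKlab : ∀ w ∈ K.nodes, ∀ x, K.lab w = Sum.inr x → w ∈ S.nodes ∧ S.lab w = Sum.inr x := by
    intro w hw x hx
    have hwS : w ∈ S.nodes ∧ w ≠ u := by
      rcases hKmem w hw with ⟨y, hy, rfl⟩ | h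
      · cases hl : Rg.lab y with
        | inl f => rw [(hfunK y hy f hl).2.1] at hx; cases hx
        | inr z =>
          have hyL := hvarL y hy z hl
          have hψy : ψ y = μ y := by simp only [hψ, hyL, if_true]
          obtain ⟨h1, h2⟩ := hbelow y hy hyL
          rw [hψy]
          exact ⟨h1, (hS.acyclic _ _ h2).symm⟩
      · exact h
    exact ⟨hwS.1, (hK w hwS.1 hwS.2).2.1.symm.trans hx⟩
  have hrep : Rep ar K (if S.root = u then H.root else S.root) t :=
    hK.rep_replAt hrepl hroot hs hup (fun q hq => hp u q hup hq)
  have hif : (if u = S.root then H.root else S.root) = if S.root = u then H.root else S.root :=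
    if_congr eq_comm rfl rfl
  have hTeq : replaceAt S u H = subgraph K (if S.root = u then H.root else S.root) := by
    rw [← hif]
    rfl
  have hT : IsTermGraph ar (replaceAt S u H) := by
    rw [hTeq]
    refine isTermGraph_subgraph hrep.mem hKrep ?_
    intro w hw w' hw' x hx hx'
    obtain ⟨h1, h2⟩ := hKlab w hw x hx
    obtain ⟨h3, h4⟩ := hKlab w' hw' x hx'
    exact hS.varShared w h1 w' h3 x h2 h4
  refine ⟨replaceAt S u H, hT, ⟨u, hup, (Lg, Rg), hLR, shift n Lg, shift n Rg,
    fun w => μ (w - n), ⟨(· + n), ?_, gIsoOn_shift n Lg, gIsoOn_shift n Rg, ?_⟩,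
    isMorphism_shift hL n hμ, rfl⟩, ?_⟩
  · intro a _ b _ hab
    exact Nat.add_right_cancel hab
  · rw [Finset.disjoint_left]
    intro w hw
    rcases Finset.mem_union.1 hw with hw | hw <;>
    · obtain ⟨y, -, rfl⟩ := Finset.mem_image.1 hw
      exact hn y
  · refine hT.rep_termOf.unique (t' := t) ?_
    rw [hTeq]
    exact hrep.subgraph .refl

end Step

/-- Adequacy, completeness direction: If `s →_{R,p} t` and
`term(S) = s`, then there are term graphs `U`, `V`, `T` with `S ▷_p^! U`,
`U ⊐_p^! V`, `V ⇒_{G(R),p} T` and `term(T) = t`. -/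
theorem adequacy_completeness {F V : Type} [Inhabited V] (ar : F → ℕ)
    (R : Set (Tm F V × Tm F V)) (hR : IsTRS R)
    (G : Set (PreGraph (F ⊕ V) × PreGraph (F ⊕ V))) (hG : IsSimGRS ar R G)
    (S : PreGraph (F ⊕ V)) (hS : IsTermGraph ar S)
    (s t : Tm F V) (hs : termOf S = s) (p : List ℕ)
    (hstep : RewriteAt R p s t) :
    ∃ U Vg T : PreGraph (F ⊕ V),
      IsTermGraph ar U ∧ IsTermGraph ar Vg ∧ IsTermGraph ar T ∧
      NormTo (UnfoldAboveTG ar p) S U ∧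
      NormTo (FoldBelowTG ar p) U Vg ∧
      GStepP G p Vg T ∧ termOf T = t := by
  obtain ⟨l, r, σ, hlr, hrepl⟩ := hstep.exists_replAt
  have hs' : Rep ar S S.root s := hs ▸ hS.rep_termOf
  have hl : ∀ x, substTm σ l ≠ Tm.var x := by
    intro x
    cases l with
    | var y => exact absurd rfl ((hR.2 _ hlr).1 y)
    | app f ts =>
      rw [substTm_app]
      simp
  obtain ⟨U, hU, hUs, hUp, hSU⟩ := exists_normTo_unfoldAboveTG hS hs' hrepl hl
  obtain ⟨Vg, hV, hVs, hVp, hUV⟩ := exists_normTo_foldBelowTG hU hUs hUp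
  obtain ⟨T, hT, hVT, hTt⟩ := exists_gStepP hG hV hVs hlr hrepl hVp hUV.2
  exact ⟨U, Vg, T, hU, hV, hT, hSU, hUV, hVT, hTt⟩

end TermGraphs
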